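/- arXiv:2503.21682 — 3 statements merged into one kernel-verified Lean document; each statement's English description precedes it below -/
import Mathlib

section
/- Let A and B be nonempty finite sets of nonzero complex numbers such that A, B, 1/A, and 1/B are pairwise disjoint, let x be a complex number, and let n be a nonnegative integer. Then Σ_{ν : ν₁ ≤ n} x^{ν₁} s_ν(A) s_ν(B) = Σ_{a∈A} Σ_{b∈B} ∏_{â∈A, â≠a}(1−â/a)^{−1} ∏_{b̂∈B, b̂≠b}(1−b̂/b)^{−1} · Σ_{0≤m≤n} (xab)^m Σ_{U⊆A∖{a}, V⊆B∖{b}, |U|=|V|} (UV)^m Z(A∖{a}∖U ∪ 1/V, B∖{b}∖V ∪ 1/U), where the first sum is over all partitions ν whose largest part ν₁ is at most n. -/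
open scoped Classical

/-- A partition: a weakly decreasing function `ℕ → ℕ` that is eventually zero. -/
structure Partn where
  p : ℕ → ℕ
  antitone' : ∀ ⦃i j : ℕ⦄, i ≤ j → p j ≤ p i
  exists_zero : ∃ n, p n = 0

/-- The number of (positive) parts of a partition. -/
noncomputable def Partn.length (ρ : Partn) : ℕ := sInf {n | ρ.p n = 0}

/-- The complete homogeneous symmetric polynomial `h_m` in `x₁,…,x_k`, with `h_m = 0`
for `m < 0`. -/
noncomputable def hsymm (k : ℕ) (m : ℤ) (x : Fin k → ℂ) : ℂ :=
  if 0 ≤ m then ∑ c ∈ Finset.Nat.antidiagonalTuple k m.toNat, ∏ i, x i ^ c i else 0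

/-- The Schur polynomial `s_ρ(x₁,…,x_k)`, via the Jacobi–Trudi formula. -/
noncomputable def schurPoly (ρ : Partn) {k : ℕ} (x : Fin k → ℂ) : ℂ :=
  Matrix.det (Matrix.of fun i j : Fin ρ.length =>
    hsymm k ((ρ.p i : ℤ) - (i : ℤ) + (j : ℤ)) x)

/-- The Schur polynomial evaluated at the members of a multiset of complex numbers. -/
noncomputable def schurMultiset (ρ : Partn) (E : Multiset ℂ) : ℂ :=
  schurPoly ρ (fun i : Fin E.toList.length => E.toList.get i)

/-- `Z(A,B) = ∏_{a∈A} ∏_{b∈B} (1 − ab)⁻¹`, with multiplicity. -/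
noncomputable def Zfac (A B : Multiset ℂ) : ℂ :=
  (A.map (fun a => (B.map (fun b => (1 - a * b)⁻¹)).prod)).prod

/-- `1/U = {u⁻¹ : u ∈ U}`. -/
noncomputable def minv (U : Multiset ℂ) : Multiset ℂ := U.map (·⁻¹)

/-- `(UV)^m = ∏_{u∈U} u^m ∏_{v∈V} v^m`. -/
noncomputable def mpow (U V : Multiset ℂ) (m : ℕ) : ℂ :=
  (U.map (· ^ m)).prod * (V.map (· ^ m)).prod

/-- The Lagrange weight `∏_{j ≠ i} (1 - x_j / x_i)⁻¹` of the node `1 / x_i`, at the point `0`. -/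
noncomputable def nodeWeight {ι : Type*} [DecidableEq ι] (s : Finset ι) (x : ι → ℂ) (i : ι) : ℂ :=
  ∏ j ∈ s.erase i, (1 - x j / x i)⁻¹

section Interpolation

open Finset Polynomial

variable {ι : Type*} [DecidableEq ι]

theorem sum_nodeWeight_mul_eval {s : Finset ι} {x : ι → ℂ} (hx : Set.InjOn x s)
    (h0 : ∀ i ∈ s, x i ≠ 0) {p : ℂ[X]} (hp : p.degree < #s) :
    ∑ i ∈ s, nodeWeight s x i * p.eval (x i)⁻¹ = p.eval 0 := by
  have hinj : Set.InjOn (fun i => (x i)⁻¹) s := fun i hi j hj h => hx hi hj (inv_injective h)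
  conv_rhs => rw [Lagrange.eq_interpolate hinj hp]
  rw [Lagrange.interpolate_apply, eval_finsetSum]
  refine sum_congr rfl fun i hi => ?_
  rw [eval_mul, eval_C, mul_comm, Lagrange.basis, eval_prod, nodeWeight]
  congr 1
  refine prod_congr rfl fun j hj => ?_
  have hi0 := h0 i hi
  have hj0 := h0 j (mem_of_mem_erase hj)
  have hne : x i - x j ≠ 0 := sub_ne_zero.2 fun h =>
    ne_of_mem_erase hj (hx (mem_of_mem_erase hj) hi h.symm)
  have hne' : x j - x i ≠ 0 := by rwa [← neg_ne_zero, neg_sub]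
  have h1 : 1 - x j / x i ≠ 0 := by
    rw [one_sub_div hi0]; exact div_ne_zero hne hi0
  have h2 : (x i)⁻¹ - (x j)⁻¹ ≠ 0 := by
    rw [inv_sub_inv hi0 hj0]; exact div_ne_zero hne' (mul_ne_zero hi0 hj0)
  simp only [Lagrange.basisDivisor, eval_mul, eval_C, eval_sub, eval_X, zero_sub]
  rw [inv_eq_iff_eq_inv, mul_inv, inv_inv, inv_neg, inv_inv]
  field_simp
  ring

theorem sum_nodeWeight {s : Finset ι} {x : ι → ℂ} (hx : Set.InjOn x s)
    (h0 : ∀ i ∈ s, x i ≠ 0) (hs : s.Nonempty) : ∑ i ∈ s, nodeWeight s x i = 1 := by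
  have h := sum_nodeWeight_mul_eval hx h0 (p := 1)
    (by rw [degree_one]; exact_mod_cast hs.card_pos)
  simpa using h

theorem nodeWeight_eq_mul {s t : Finset ι} (hts : t ⊆ s) (x : ι → ℂ) {i : ι} (hi : i ∈ t) :
    nodeWeight s x i = nodeWeight t x i * ∏ j ∈ s \ t, (1 - x j / x i)⁻¹ := by
  rw [nodeWeight, nodeWeight, mul_comm, ← prod_sdiff (erase_subset_erase i hts)]
  congr 1
  refine prod_congr ?_ fun _ _ => rfl
  ext j
  simp only [mem_sdiff, mem_erase]
  constructor
  · rintro ⟨⟨h1, h2⟩, h3⟩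
    exact ⟨h2, fun h => h3 ⟨h1, h⟩⟩
  · rintro ⟨h1, h2⟩
    exact ⟨⟨fun h => h2 (h ▸ hi), h1⟩, fun h => h2 h.2⟩

theorem sum_sum_powerset_erase {M : Type*} [AddCommMonoid M] (s : Finset ι)
    (f : ι → Finset ι → M) :
    ∑ a ∈ s, ∑ U ∈ (s.erase a).powerset, f a U = ∑ U ∈ s.powerset, ∑ a ∈ U, f a (U.erase a) := by
  rw [sum_sigma', sum_sigma']
  refine sum_bij' (fun p _ => ⟨insert p.1 p.2, p.1⟩) (fun p _ => ⟨p.2, p.1.erase p.2⟩)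
    ?_ ?_ ?_ ?_ ?_
  · rintro ⟨a, U⟩ h
    simp only [mem_sigma, mem_powerset] at h ⊢
    exact ⟨insert_subset h.1 (h.2.trans (erase_subset _ _)), mem_insert_self _ _⟩
  · rintro ⟨U, a⟩ h
    simp only [mem_sigma, mem_powerset] at h ⊢
    exact ⟨h.1 h.2, erase_subset_erase _ h.1⟩
  · rintro ⟨a, U⟩ h
    simp only [mem_sigma, mem_powerset] at h
    simp [erase_insert (fun ha => notMem_erase a s (h.2 ha))]
  · rintro ⟨U, a⟩ h
    simp only [mem_sigma, mem_powerset] at h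
    simp [insert_erase h.2]
  · rintro ⟨a, U⟩ h
    simp only [mem_sigma, mem_powerset] at h
    simp [erase_insert (fun ha => notMem_erase a s (h.2 ha))]

theorem erase_sdiff_erase_of_mem (s : Finset ι) {t : Finset ι} {a : ι}
    (ha : a ∈ t) : s.erase a \ t.erase a = s \ t := by
  ext j
  simp only [mem_sdiff, mem_erase]
  constructor
  · rintro ⟨⟨h1, h2⟩, h3⟩
    exact ⟨h2, fun h => h3 ⟨h1, h⟩⟩
  · rintro ⟨h1, h2⟩
    exact ⟨⟨fun h => h2 (h ▸ ha), h1⟩, fun h => h2 h.2⟩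

theorem sum_powersetCard_prod_inv {x : ι → ℂ} (l : ℕ) {s : Finset ι} (hx : Set.InjOn x s)
    (h0 : ∀ i ∈ s, x i ≠ 0) (hl : l ≤ #s) :
    ∑ T ∈ s.powersetCard l, ∏ t ∈ T, ∏ r ∈ s \ T, (1 - x r / x t)⁻¹ = 1 := by
  induction l generalizing s with
  | zero => simp
  | succ l ih =>
    have hs : s.Nonempty := card_pos.1 (by omega)
    symm
    calc (1 : ℂ) = ∑ a ∈ s, ∑ T ∈ (s.erase a).powerset, if #T = l then
            nodeWeight s x a * ∏ t ∈ T, ∏ r ∈ (s.erase a) \ T, (1 - x r / x t)⁻¹ else 0 := by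
          refine (sum_nodeWeight hx h0 hs).symm.trans ?_
          refine sum_congr rfl fun a ha => ?_
          rw [← sum_filter, ← powersetCard_eq_filter, ← mul_sum, ih, mul_one]
          · exact hx.mono (by simp)
          · exact fun i hi => h0 i (mem_of_mem_erase hi)
          · rw [card_erase_of_mem ha]; omega
      _ = _ := by
          rw [sum_sum_powerset_erase s fun a T => if #T = l then
            nodeWeight s x a * ∏ t ∈ T, ∏ r ∈ (s.erase a) \ T, (1 - x r / x t)⁻¹ else 0,
            powersetCard_eq_filter, sum_filter]
          refine sum_congr rfl fun T hT => ?_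
          rw [mem_powerset] at hT
          split_ifs with hc
          · have hT0 : T.Nonempty := card_pos.1 (by omega)
            have hw := sum_nodeWeight (hx.mono (by simpa using hT)) (fun i hi => h0 i (hT hi)) hT0
            refine Eq.trans ?_ ((congrArg (· * _) hw).trans (one_mul _))
            simp only [sum_mul]
            refine sum_congr rfl fun a ha => ?_
            rw [if_pos (by rw [card_erase_of_mem ha]; omega), erase_sdiff_erase_of_mem s ha,
              nodeWeight_eq_mul hT x ha, ← mul_prod_erase T _ ha]
            ring
          · refine sum_eq_zero fun a ha => if_neg ?_
            rw [card_erase_of_mem ha]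
            have := card_pos.2 ⟨a, ha⟩
            omega

end Interpolation

section RectangularSum

open Finset Polynomial

/-- The product `Z(P ∪ 1/V, Q ∪ 1/U)`, split into its four blocks. -/
noncomputable def crossKernel (P U Q V : Finset ℂ) : ℂ :=
  (∏ p ∈ P, ∏ q ∈ Q, (1 - p * q)⁻¹) * (∏ p ∈ P, ∏ u ∈ U, (1 - p * u⁻¹)⁻¹) *
    (∏ v ∈ V, ∏ q ∈ Q, (1 - v⁻¹ * q)⁻¹) * ∏ v ∈ V, ∏ u ∈ U, (1 - v⁻¹ * u⁻¹)⁻¹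

/-- The sum `∑_{U ⊆ A, V ⊆ B, |U| = |V|} (UV)^m Z(A∖U ∪ 1/V, B∖V ∪ 1/U)`. -/
noncomputable def rectSum (m : ℕ) (A B : Finset ℂ) : ℂ :=
  ∑ U ∈ A.powerset, ∑ V ∈ B.powerset with #V = #U,
    (∏ u ∈ U, u) ^ m * (∏ v ∈ V, v) ^ m * crossKernel (A \ U) U (B \ V) V

theorem crossKernel_eq_erase_left (P Q V : Finset ℂ) {U : Finset ℂ} {a : ℂ} (ha : a ∈ U) :
    crossKernel P U Q V = crossKernel P (U.erase a) Q V * (∏ p ∈ P, (1 - p * a⁻¹)⁻¹) *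
      ∏ v ∈ V, (1 - v⁻¹ * a⁻¹)⁻¹ := by
  simp only [crossKernel, ← mul_prod_erase U _ ha, prod_mul_distrib]
  ring

theorem crossKernel_eq_erase_right (P U Q : Finset ℂ) {V : Finset ℂ} {b : ℂ} (hb : b ∈ V) :
    crossKernel P U Q V = crossKernel P U Q (V.erase b) * (∏ q ∈ Q, (1 - q * b⁻¹)⁻¹) *
      ∏ u ∈ U, (1 - b⁻¹ * u⁻¹)⁻¹ := by
  simp only [crossKernel, ← mul_prod_erase V _ hb, mul_comm _ b⁻¹]
  ring

theorem sum_sum_nodeWeight_mul_prod {U V : Finset ℂ} (hU : 0 ∉ U) (hV : 0 ∉ V) (hc : #V = #U) :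
    ∑ a ∈ U, ∑ b ∈ V, nodeWeight U id a * nodeWeight V id b *
      ((∏ v ∈ V, (1 - v⁻¹ * a⁻¹)) * ∏ u ∈ U.erase a, (1 - b⁻¹ * u⁻¹)) =
    1 - ((∏ u ∈ U, u) * ∏ v ∈ V, v)⁻¹ := by
  have hU0 : ∀ i ∈ U, id i ≠ (0 : ℂ) := fun i hi h => hU (h ▸ hi)
  have hV0 : ∀ i ∈ V, id i ≠ (0 : ℂ) := fun i hi h => hV (h ▸ hi)
  have inner : ∀ a ∈ U, ∑ b ∈ V, nodeWeight V id b * ∏ u ∈ U.erase a, (1 - b⁻¹ * u⁻¹) = 1 := by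
    intro a ha
    have h := sum_nodeWeight_mul_eval (Function.injective_id.injOn (s := (V : Set ℂ))) hV0
      (p := ∏ u ∈ U.erase a, (1 - X * C u⁻¹)) ?_
    · simpa only [eval_prod, eval_sub, eval_mul, eval_C, eval_X, eval_one, zero_mul, sub_zero,
        prod_const_one, id] using h
    · refine (degree_prod_le _ _).trans_lt ?_
      have h1 : ∑ u ∈ U.erase a, degree (1 - X * C u⁻¹ : ℂ[X]) ≤ ∑ u ∈ U.erase a, 1 :=
        sum_le_sum fun u _ => by compute_degree
      refine h1.trans_lt ?_
      rw [sum_const, card_erase_of_mem ha, hc, nsmul_one]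
      have := card_pos.2 ⟨a, ha⟩
      exact_mod_cast Nat.sub_lt this one_pos
  have outer : ∑ a ∈ U, nodeWeight U id a * ∏ v ∈ V, (1 - v⁻¹ * a⁻¹) =
      1 - ((∏ u ∈ U, u) * ∏ v ∈ V, v)⁻¹ := by
    set c := ((∏ u ∈ U, u) * ∏ v ∈ V, v)⁻¹ with hcdef
    have key : (∏ v ∈ V, (1 - C v⁻¹ * X) - C c * ∏ u ∈ U, (1 - C u * X) : ℂ[X]).degree < #U := by
      have hd : ∀ (S : Finset ℂ) (f : ℂ → ℂ), (∏ s ∈ S, (1 - C (f s) * X) : ℂ[X]).natDegree ≤ #S := by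
        intro S f
        refine (natDegree_prod_le _ _).trans ?_
        refine (sum_le_card_nsmul S _ 1 fun s _ => ?_).trans (by simp)
        compute_degree
      have hl : ∀ (S : Finset ℂ) (f : ℂ → ℂ),
          (∏ s ∈ S, (1 - C (f s) * X) : ℂ[X]).coeff #S = ∏ s ∈ S, (- f s) := by
        intro S f
        have := coeff_prod_of_natDegree_le S (fun s => (1 - C (f s) * X : ℂ[X])) 1
          (fun s _ => by compute_degree)
        rw [mul_one] at this
        rw [this]
        refine prod_congr rfl fun s _ => ?_
        simp [coeff_one]
      rw [degree_lt_iff_coeff_zero]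
      intro k hk
      rw [coeff_sub, coeff_C_mul]
      rcases hk.eq_or_lt with rfl | hk
      · rw [hl U fun u => u, ← hc, hl V fun v => v⁻¹, prod_neg, prod_neg, hc, prod_inv_distrib]
        have h1 : ∏ u ∈ U, u ≠ 0 := prod_ne_zero_iff.2 hU0
        rw [hcdef, mul_inv]
        field_simp
        ring
      · rw [coeff_eq_zero_of_natDegree_lt ((hd V _).trans_lt (hc ▸ hk)),
          coeff_eq_zero_of_natDegree_lt ((hd U fun u => u).trans_lt hk), mul_zero, sub_zero]
    have h := sum_nodeWeight_mul_eval (Function.injective_id.injOn (s := (U : Set ℂ))) hU0 key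
    simp only [eval_sub, eval_prod, eval_mul, eval_C, eval_X, eval_one, mul_zero, sub_zero,
      prod_const_one, mul_one, id] at h
    rw [← h]
    refine sum_congr rfl fun a ha => ?_
    have h1 : ∏ u ∈ U, (1 - u * a⁻¹) = 0 :=
      prod_eq_zero ha (sub_eq_zero.2 (mul_inv_cancel₀ (hU0 a ha)).symm)
    rw [h1, mul_zero, sub_zero]
  rw [← outer]
  refine sum_congr rfl fun a ha => ?_
  refine Eq.trans ?_ ((congrArg (nodeWeight U id a * (∏ v ∈ V, (1 - v⁻¹ * a⁻¹)) * ·)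
    (inner a ha)).trans (mul_one _))
  simp only [mul_sum]
  exact sum_congr rfl fun b _ => by ring

theorem nodeWeight_mul_crossKernel_erase {A B U V : Finset ℂ} (hU : U ⊆ A) (hV : V ⊆ B)
    (hAB : ∀ a ∈ A, ∀ b ∈ B, a * b ≠ 1) {a b : ℂ} (ha : a ∈ U)
    (hb : b ∈ V) :
    nodeWeight A id a * nodeWeight B id b *
        crossKernel (A \ U) (U.erase a) (B \ V) (V.erase b) =
      nodeWeight U id a * nodeWeight V id b *
        ((∏ v ∈ V, (1 - v⁻¹ * a⁻¹)) * ∏ u ∈ U.erase a, (1 - b⁻¹ * u⁻¹)) *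
        crossKernel (A \ U) U (B \ V) V := by
  have hne : ∀ v ∈ V, ∀ u ∈ U, 1 - v⁻¹ * u⁻¹ ≠ 0 := by
    intro v hv u hu h
    have := hAB u (hU hu) v (hV hv)
    rw [← mul_inv, sub_eq_zero, eq_comm, inv_eq_one, mul_comm] at h
    exact this h
  have h1 : (∏ v ∈ V, (1 - v⁻¹ * a⁻¹)) * ∏ v ∈ V, (1 - v⁻¹ * a⁻¹)⁻¹ = 1 := by
    rw [← prod_mul_distrib]
    exact prod_eq_one fun v hv => mul_inv_cancel₀ (hne v hv a ha)
  have h2 : (∏ u ∈ U.erase a, (1 - b⁻¹ * u⁻¹)) * ∏ u ∈ U.erase a, (1 - b⁻¹ * u⁻¹)⁻¹ = 1 := by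
    rw [← prod_mul_distrib]
    exact prod_eq_one fun u hu => mul_inv_cancel₀ (hne b hb u (mem_of_mem_erase hu))
  rw [crossKernel_eq_erase_left _ _ _ ha, crossKernel_eq_erase_right _ _ _ hb,
    nodeWeight_eq_mul hU id ha, nodeWeight_eq_mul hV id hb]
  simp only [id, div_eq_mul_inv]
  linear_combination -(nodeWeight U id a * nodeWeight V id b *
    (∏ p ∈ A \ U, (1 - p * a⁻¹)⁻¹) * (∏ q ∈ B \ V, (1 - q * b⁻¹)⁻¹) *
    crossKernel (A \ U) (U.erase a) (B \ V) (V.erase b)) *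
    (h1 * ((∏ u ∈ U.erase a, (1 - b⁻¹ * u⁻¹)) * ∏ u ∈ U.erase a, (1 - b⁻¹ * u⁻¹)⁻¹) + h2)

theorem rectSum_succ {A B : Finset ℂ} (hA : 0 ∉ A) (hB : 0 ∉ B)
    (hAB : ∀ a ∈ A, ∀ b ∈ B, a * b ≠ 1) (m : ℕ) :
    rectSum (m + 1) A B = rectSum m A B + ∑ a ∈ A, ∑ b ∈ B,
      nodeWeight A id a * nodeWeight B id b * (a * b) ^ (m + 1) *
        rectSum (m + 1) (A.erase a) (B.erase b) := by
  have h : ∑ a ∈ A, ∑ b ∈ B, nodeWeight A id a * nodeWeight B id b * (a * b) ^ (m + 1) *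
        rectSum (m + 1) (A.erase a) (B.erase b) =
      ∑ U ∈ A.powerset, ∑ a ∈ U, ∑ V ∈ B.powerset, ∑ b ∈ V,
        if #(V.erase b) = #(U.erase a) then
          nodeWeight A id a * nodeWeight B id b * (a * b) ^ (m + 1) *
            ((∏ u ∈ U.erase a, u) ^ (m + 1) * (∏ v ∈ V.erase b, v) ^ (m + 1) *
            crossKernel (A.erase a \ U.erase a) (U.erase a) (B.erase b \ V.erase b) (V.erase b))
        else 0 := by
    rw [← sum_sum_powerset_erase A fun a U => ∑ V ∈ B.powerset, ∑ b ∈ V,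
        if #(V.erase b) = #U then
          nodeWeight A id a * nodeWeight B id b * (a * b) ^ (m + 1) *
            ((∏ u ∈ U, u) ^ (m + 1) * (∏ v ∈ V.erase b, v) ^ (m + 1) *
            crossKernel (A.erase a \ U) U (B.erase b \ V.erase b) (V.erase b))
        else 0]
    refine sum_congr rfl fun a _ => ?_
    rw [sum_congr rfl fun U _ => (sum_sum_powerset_erase B fun b V =>
        if #V = #U then
          nodeWeight A id a * nodeWeight B id b * (a * b) ^ (m + 1) *
            ((∏ u ∈ U, u) ^ (m + 1) * (∏ v ∈ V, v) ^ (m + 1) *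
            crossKernel (A.erase a \ U) U (B.erase b \ V) V)
        else 0).symm, sum_comm]
    refine sum_congr rfl fun b _ => ?_
    simp only [rectSum, mul_sum, sum_filter]
    refine sum_congr rfl fun U _ => sum_congr rfl fun V _ => ?_
    split_ifs <;> simp
  rw [h, rectSum, rectSum, ← sum_add_distrib]
  refine sum_congr rfl fun U hU => ?_
  rw [mem_powerset] at hU
  rw [sum_comm, sum_filter, sum_filter, ← sum_add_distrib]
  refine sum_congr rfl fun V hV => ?_
  rw [mem_powerset] at hV
  have hcard : ∀ a ∈ U, ∀ b ∈ V, (#(V.erase b) = #(U.erase a) ↔ #V = #U) := by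
    intro a ha b hb
    rw [card_erase_of_mem ha, card_erase_of_mem hb]
    have h1 := card_pos.2 ⟨a, ha⟩
    have h2 := card_pos.2 ⟨b, hb⟩
    omega
  split_ifs with hc
  · have hU0 : ∏ u ∈ U, u ≠ 0 := prod_ne_zero_iff.2 fun u hu h => hA (h ▸ hU hu)
    have hV0 : ∏ v ∈ V, v ≠ 0 := prod_ne_zero_iff.2 fun v hv h => hB (h ▸ hV hv)
    have key := sum_sum_nodeWeight_mul_prod (fun h => hA (hU h)) (fun h => hB (hV h)) hc
    have : ∑ a ∈ U, ∑ b ∈ V, (if #(V.erase b) = #(U.erase a) then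
          nodeWeight A id a * nodeWeight B id b * (a * b) ^ (m + 1) *
            ((∏ u ∈ U.erase a, u) ^ (m + 1) * (∏ v ∈ V.erase b, v) ^ (m + 1) *
            crossKernel (A.erase a \ U.erase a) (U.erase a) (B.erase b \ V.erase b) (V.erase b))
        else 0) = (∑ a ∈ U, ∑ b ∈ V, nodeWeight U id a * nodeWeight V id b *
      ((∏ v ∈ V, (1 - v⁻¹ * a⁻¹)) * ∏ u ∈ U.erase a, (1 - b⁻¹ * u⁻¹))) *
        (((∏ u ∈ U, u) * ∏ v ∈ V, v) ^ (m + 1) * crossKernel (A \ U) U (B \ V) V) := by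
      rw [sum_mul]
      refine sum_congr rfl fun a ha => ?_
      rw [sum_mul]
      refine sum_congr rfl fun b hb => ?_
      rw [if_pos ((hcard a ha b hb).2 hc), erase_sdiff_erase_of_mem _ ha,
        erase_sdiff_erase_of_mem _ hb, ← mul_prod_erase U (fun u => u) ha,
        ← mul_prod_erase V (fun v => v) hb]
      have := nodeWeight_mul_crossKernel_erase hU hV hAB ha hb
      simp only [mul_pow]
      linear_combination (a ^ (m + 1) * b ^ (m + 1) * (∏ u ∈ U.erase a, u) ^ (m + 1) *
        (∏ v ∈ V.erase b, v) ^ (m + 1)) * this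
    rw [this, key]
    field_simp
    ring
  · rw [zero_add]
    refine (sum_eq_zero fun a ha => sum_eq_zero fun b hb => if_neg ?_).symm
    rwa [hcard a ha b hb]

theorem rectSum_zero {A B : Finset ℂ} (hA : 0 ∉ A) (hB : 0 ∉ B)
    (hAB : ∀ a ∈ A, ∀ b ∈ B, a * b ≠ 1) : rectSum 0 A B = 1 := by
  set x : ℂ ⊕ ℂ → ℂ := Sum.elim id (·⁻¹) with hx
  have hinj : Set.InjOn x (A.disjSum B : Finset (ℂ ⊕ ℂ)) := by
    rintro (a | a) ha (b | b) hb h <;>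
      simp only [mem_coe, inl_mem_disjSum, inr_mem_disjSum, hx, Sum.elim_inl,
        Sum.elim_inr, id] at ha hb h
    · rw [h]
    · refine absurd ?_ (hAB a ha b hb)
      rw [h, inv_mul_cancel₀ fun h0 => hB (h0 ▸ hb)]
    · refine absurd ?_ (hAB b hb a ha)
      rw [← h, inv_mul_cancel₀ fun h0 => hB (h0 ▸ ha)]
    · rw [inv_injective h]
  have h0 : ∀ i ∈ A.disjSum B, x i ≠ 0 := by
    rintro (a | b) h
    · rw [inl_mem_disjSum] at h
      exact fun h0 => hA (h0 ▸ h)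
    · rw [inr_mem_disjSum] at h
      exact inv_ne_zero fun h0 => hB (h0 ▸ h)
  rw [← sum_powersetCard_prod_inv #B hinj h0 (by rw [card_disjSum]; omega), rectSum, sum_sigma']
  refine sum_bij' (fun p _ => p.1.disjSum (B \ p.2)) (fun T _ => ⟨T.toLeft, B \ T.toRight⟩)
    ?_ ?_ ?_ ?_ ?_
  · rintro ⟨U, V⟩ h
    simp only [mem_sigma, mem_powerset, mem_filter] at h
    rw [mem_powersetCard, card_disjSum, card_sdiff_of_subset h.2.1]
    refine ⟨disjSum_mono h.1 sdiff_subset, ?_⟩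
    have := card_le_card h.2.1
    dsimp only at this ⊢
    omega
  · intro T h
    rw [mem_powersetCard, subset_disjSum] at h
    simp only [mem_sigma, mem_powerset, mem_filter]
    refine ⟨h.1.1, sdiff_subset, ?_⟩
    have h1 := card_toLeft_add_card_toRight (u := T)
    rw [card_sdiff_of_subset h.1.2]
    omega
  · rintro ⟨U, V⟩ h
    simp only [mem_sigma, mem_powerset, mem_filter] at h
    simp [inter_eq_right.2 h.2.1]
  · intro T h
    rw [mem_powersetCard, subset_disjSum] at h
    simp [inter_eq_right.2 h.1.2, toLeft_disjSum_toRight]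
  · rintro ⟨U, V⟩ h
    simp only [mem_sigma, mem_powerset, mem_filter] at h
    have hsd : A.disjSum B \ U.disjSum (B \ V) = (A \ U).disjSum V := by
      ext (j | j)
      · simp
      · have := @h.2.1 j
        simp
        tauto
    rw [hsd]
    simp only [prod_disjSum, hx, Sum.elim_inl, Sum.elim_inr, id, crossKernel, prod_mul_distrib,
      div_eq_mul_inv, inv_inv, pow_zero, one_mul]
    rw [prod_comm (s := A \ U) (t := B \ V), prod_comm (s := A \ U) (t := U),
      prod_comm (s := V) (t := B \ V), prod_comm (s := V) (t := U)]
    ring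

theorem rectSum_empty_left (m : ℕ) (B : Finset ℂ) : rectSum m ∅ B = 1 := by
  simp [rectSum, crossKernel, sum_filter]

theorem rectSum_empty_right (m : ℕ) (A : Finset ℂ) : rectSum m A ∅ = 1 := by
  rw [rectSum, sum_eq_single ∅]
  · simp [crossKernel, sum_filter]
  · intro U _ hU
    simp [sum_filter, eq_comm, hU]
  · simp

end RectangularSum

section Schur

open Finset PowerSeries

/-- The generating series `∏_{a ∈ E} (1 - aX)⁻¹` of the complete homogeneous polynomials. -/
noncomputable def hSeries (E : Finset ℂ) : ℂ⟦X⟧ := ∏ a ∈ E, PowerSeries.mk fun n => a ^ n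

/-- The complete homogeneous symmetric polynomial `h_m` evaluated at a finite set. -/
noncomputable def hFin (E : Finset ℂ) (m : ℤ) : ℂ :=
  if 0 ≤ m then coeff m.toNat (hSeries E) else 0

theorem hsymm_eq_coeff (k : ℕ) (m : ℕ) (x : Fin k → ℂ) :
    hsymm k m x = coeff m (∏ i, PowerSeries.mk fun n => x i ^ n) := by
  rw [hsymm, if_pos (by positivity), Int.toNat_natCast, coeff_prod]
  simp only [coeff_mk]
  refine sum_bij' (fun c _ => Finsupp.equivFunOnFinite.symm c) (fun l _ => ⇑l) ?_ ?_ ?_ ?_ ?_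
  · intro c hc
    simpa [mem_finsuppAntidiag, Finset.Nat.mem_antidiagonalTuple] using hc
  · intro l hl
    simpa [mem_finsuppAntidiag, Finset.Nat.mem_antidiagonalTuple] using hl
  · intro c _; rfl
  · intro l _; ext; rfl
  · intro c _; rfl

theorem hsymm_toList (E : Finset ℂ) (m : ℤ) :
    hsymm E.val.toList.length m (fun i => E.val.toList.get i) = hFin E m := by
  rw [hFin]
  split_ifs with hm
  · lift m to ℕ using hm
    rw [hsymm_eq_coeff, Int.toNat_natCast, hSeries]
    congr 1
    simp only [List.get_eq_getElem]
    rw [Fin.prod_univ_fun_getElem E.val.toList fun a => PowerSeries.mk fun n => a ^ n,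
      ← Multiset.prod_coe, ← Multiset.map_coe, Multiset.coe_toList, Finset.prod]
  · rw [hsymm, if_neg hm]

theorem hFin_of_neg (E : Finset ℂ) {m : ℤ} (hm : m < 0) : hFin E m = 0 := if_neg (not_le.2 hm)

theorem hFin_zero (E : Finset ℂ) : hFin E 0 = 1 := by
  rw [hFin, if_pos le_rfl, Int.toNat_zero, hSeries, coeff_zero_eq_constantCoeff_apply, map_prod]
  exact prod_eq_one fun a _ => by simp [← coeff_zero_eq_constantCoeff_apply]

theorem hFin_empty {m : ℤ} (hm : m ≠ 0) : hFin ∅ m = 0 := by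
  rw [hFin]
  split_ifs with h
  · rw [hSeries, prod_empty, coeff_one, if_neg (by omega)]
  · rfl

theorem hFin_eq_erase_add {E : Finset ℂ} {a : ℂ} (ha : a ∈ E) (m : ℤ) :
    hFin E m = hFin (E.erase a) m + a * hFin E (m - 1) := by
  rcases lt_trichotomy m 0 with hm | rfl | hm
  · rw [hFin_of_neg _ hm, hFin_of_neg _ hm, hFin_of_neg _ (by omega), mul_zero, add_zero]
  · rw [hFin_zero, hFin_zero, hFin_of_neg _ (by omega), mul_zero, add_zero]
  · obtain ⟨n, rfl⟩ : ∃ n : ℕ, m = n + 1 := ⟨(m - 1).toNat, by omega⟩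
    have hgeom : (PowerSeries.mk fun n => a ^ n) = 1 + C a * X * PowerSeries.mk fun n => a ^ n := by
      ext k
      rcases k with - | k
      · simp [mul_assoc]
      · rw [map_add, mul_assoc, coeff_C_mul, coeff_succ_X_mul, coeff_mk, coeff_mk, coeff_one,
          if_neg (Nat.succ_ne_zero k), zero_add, pow_succ']
    have hE : hSeries E = hSeries (E.erase a) + C a * (X * hSeries E) := by
      rw [hSeries, hSeries, ← mul_prod_erase E _ ha]
      linear_combination (∏ x ∈ E.erase a, PowerSeries.mk fun n => x ^ n) * hgeom
    rw [hFin, hFin, hFin, if_pos (by omega), if_pos (by omega), if_pos (by omega)]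
    have h1 : ((n : ℤ) + 1).toNat = n + 1 := by omega
    have h2 : ((n : ℤ) + 1 - 1).toNat = n := by omega
    rw [h1, h2]
    conv_lhs => rw [hE]
    rw [map_add, coeff_C_mul, coeff_succ_X_mul]

theorem sum_nodeWeight_mul_pow_succ {E : Finset ℂ} (hE : 0 ∉ E) {c : ℂ} (hc : c ∈ E) (m : ℕ) :
    ∑ a ∈ E, nodeWeight E id a * a ^ (m + 1) =
      ∑ a ∈ E.erase c, nodeWeight (E.erase c) id a * a ^ (m + 1) +
        c * ∑ a ∈ E, nodeWeight E id a * a ^ m := by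
  rw [mul_sum, ← sub_eq_iff_eq_add, ← sum_sub_distrib, ← add_sum_erase E _ hc]
  rw [show nodeWeight E id c * c ^ (m + 1) - c * (nodeWeight E id c * c ^ m) = 0 by ring, zero_add]
  refine sum_congr rfl fun a ha => ?_
  have hac : a - c ≠ 0 := sub_ne_zero.2 (ne_of_mem_erase ha)
  have ha0 : a ≠ 0 := fun h => hE (h ▸ mem_of_mem_erase ha)
  have hsd : E \ E.erase c = {c} := by simp [sdiff_erase_self, hc]
  rw [nodeWeight_eq_mul (erase_subset c E) id ha, hsd, prod_singleton, id, id, one_sub_div ha0,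
    inv_div]
  field_simp
  ring

theorem sum_nodeWeight_mul_pow {E : Finset ℂ} (hE : 0 ∉ E) (hne : E.Nonempty) (m : ℕ) :
    ∑ a ∈ E, nodeWeight E id a * a ^ m = hFin E m := by
  have zero : ∀ E : Finset ℂ, 0 ∉ E → E.Nonempty →
      ∑ a ∈ E, nodeWeight E id a * a ^ 0 = hFin E (0 : ℕ) := by
    intro E hE hne
    have := sum_nodeWeight (Function.injective_id.injOn (s := (E : Set ℂ)))
      (fun i hi h => hE (h ▸ hi)) hne
    simpa [hFin_zero] using this
  have succ : ∀ E : Finset ℂ, 0 ∉ E → ∀ m : ℕ,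
      ∑ a ∈ E, nodeWeight E id a * a ^ (m + 1) = hFin E (m + 1 : ℕ) := by
    intro E
    induction E using Finset.induction with
    | empty => intro _ m; rw [hFin_empty (by omega), sum_empty]
    | insert c F hc ih =>
      intro hE m
      have hcE := mem_insert_self c F
      have ih' := ih fun h => hE (mem_insert_of_mem h)
      induction m with
      | zero =>
        rw [sum_nodeWeight_mul_pow_succ hE hcE, hFin_eq_erase_add hcE, erase_insert hc, ih',
          zero _ hE ⟨c, hcE⟩]
        simp
      | succ m ihm =>
        rw [sum_nodeWeight_mul_pow_succ hE hcE, hFin_eq_erase_add hcE, erase_insert hc, ih', ihm]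
        simp
  rcases m with - | m
  · exact zero E hE hne
  · exact succ E hE m

/-- The determinant of complete homogeneous polynomials over `n` rows. -/
noncomputable def jacobiTrudi (E : Finset ℂ) (n : ℕ) (p : ℕ → ℕ) : ℂ :=
  Matrix.det (Matrix.of fun i j : Fin n => hFin E ((p i : ℤ) - (i : ℤ) + (j : ℤ)))

theorem jacobiTrudi_succ {E : Finset ℂ} (hE : 0 ∉ E) (hne : E.Nonempty) (n : ℕ) (p : ℕ → ℕ) :
    jacobiTrudi E (n + 1) p = ∑ a ∈ E, nodeWeight E id a * a ^ p 0 *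
      jacobiTrudi (E.erase a) n fun i => p (i + 1) := by
  set M : Matrix (Fin (n + 1)) (Fin (n + 1)) ℂ :=
    Matrix.of fun i j => hFin E ((p i : ℤ) - (i : ℤ) + (j : ℤ)) with hM
  have hrow : M = M.updateRow 0 (∑ a ∈ E, (nodeWeight E id a * a ^ p 0) •
      fun j : Fin (n + 1) => a ^ (j : ℕ)) := by
    ext i j
    refine Fin.cases ?_ (fun i => ?_) i
    · rw [Matrix.updateRow_self, hM, Matrix.of_apply, Finset.sum_apply]
      simp only [Pi.smul_apply, smul_eq_mul, Fin.val_zero, Nat.cast_zero, sub_zero, mul_assoc,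
        ← pow_add]
      rw [sum_nodeWeight_mul_pow hE hne, Nat.cast_add]
    · rw [Matrix.updateRow_ne (Fin.succ_ne_zero i)]
  have hdet : ∀ a ∈ E, (M.updateRow 0 fun j : Fin (n + 1) => a ^ (j : ℕ)).det =
      jacobiTrudi (E.erase a) n fun i => p (i + 1) := by
    intro a ha
    rw [Matrix.det_eq_of_forall_col_eq_smul_add_pred (B := Matrix.of fun i j =>
      Fin.cases (motive := fun _ => ℂ) (Fin.cases (motive := fun _ => ℂ) 1 (fun _ => 0) j)
        (fun i => Fin.cases (motive := fun _ => ℂ) (M i.succ 0)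
          (fun j => hFin (E.erase a) ((p (i + 1) : ℤ) - (i : ℤ) + (j : ℤ))) j) i) (fun _ => a)]
    · rw [Matrix.det_succ_row_zero, Fin.sum_univ_succ]
      simp [jacobiTrudi, Matrix.submatrix]
    · intro i
      refine Fin.cases ?_ (fun i => ?_) i
      · simp
      · simp
    · intro i j
      refine Fin.cases ?_ (fun i => ?_) i
      · simp [pow_succ']
      · rw [Matrix.updateRow_ne (Fin.succ_ne_zero i)]
        simp only [hM, Matrix.of_apply, Fin.cases_succ, Fin.val_succ, Fin.val_castSucc]
        rw [hFin_eq_erase_add ha]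
        have h1 : (p (i + 1) : ℤ) - ((i + 1 : ℕ) : ℤ) + ((j + 1 : ℕ) : ℤ) = p (i + 1) - i + j := by
          push_cast; ring
        have h2 : (p (i + 1) : ℤ) - i + j - 1 = p (i + 1) - ((i + 1 : ℕ) : ℤ) + (j : ℕ) := by
          push_cast; ring
        rw [h1, h2]
  rw [jacobiTrudi, ← hM, hrow]
  refine ((Matrix.detRowAlternating (R := ℂ)).toMultilinearMap.map_update_sum E 0
    (fun a => (nodeWeight E id a * a ^ p 0) • fun j : Fin (n + 1) => a ^ (j : ℕ)) M).trans ?_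
  refine sum_congr rfl fun a ha => ?_
  rw [← hdet a ha]
  exact Matrix.det_updateRow_smul M 0 _ _

end Schur

section Partitions

open Finset

theorem Partn.p_injective : Function.Injective Partn.p := by
  rintro ⟨p, _, _⟩ ⟨q, _, _⟩ rfl
  rfl

theorem Partn.length_le_iff (ν : Partn) (n : ℕ) : ν.length ≤ n ↔ ν.p n = 0 :=
  ⟨fun h => Nat.eq_zero_of_le_zero ((ν.antitone' h).trans_eq (Nat.sInf_mem ν.exists_zero)),
    fun h => Nat.sInf_le h⟩

/-- The empty partition. -/
def Partn.zero : Partn := ⟨fun _ => 0, fun _ _ _ => le_rfl, 0, rfl⟩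

/-- Add a part in front of a partition, enlarged if necessary to be the largest part. -/
def Partn.cons (m : ℕ) (μ : Partn) : Partn where
  p i := Nat.casesOn i (max m (μ.p 0)) μ.p
  antitone' := by
    rintro (- | i) (- | j) h
    · exact le_rfl
    · exact (μ.antitone' (Nat.zero_le j)).trans (le_max_right _ _)
    · omega
    · exact μ.antitone' (Nat.le_of_succ_le_succ h)
  exists_zero := by
    obtain ⟨n, hn⟩ := μ.exists_zero
    exact ⟨n + 1, hn⟩

theorem Partn.cons_p_zero {m : ℕ} {μ : Partn} (h : μ.p 0 ≤ m) : (Partn.cons m μ).p 0 = m :=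
  max_eq_left h

theorem Partn.cons_p_succ (m : ℕ) (μ : Partn) (i : ℕ) : (Partn.cons m μ).p (i + 1) = μ.p i := rfl

theorem Partn.cons_injective (m : ℕ) : Function.Injective (Partn.cons m) := fun _ _ h =>
  Partn.p_injective <| funext fun i => congrArg (fun ν : Partn => ν.p (i + 1)) h

theorem Partn.exists_eq_cons (ν : Partn) :
    ∃ μ : Partn, μ.p 0 ≤ ν.p 0 ∧ ν = Partn.cons (ν.p 0) μ := by
  obtain ⟨n, hn⟩ := ν.exists_zero
  refine ⟨⟨fun i => ν.p (i + 1), fun i j h => ν.antitone' (by omega), n,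
    Nat.eq_zero_of_le_zero ((ν.antitone' n.le_succ).trans_eq hn)⟩, ν.antitone' zero_le_one,
    Partn.p_injective <| funext fun i => ?_⟩
  rcases i with - | i
  · exact (max_eq_left (ν.antitone' zero_le_one)).symm
  · rfl

theorem Partn.length_cons {m : ℕ} {μ : Partn} (hm : m ≠ 0) :
    (Partn.cons m μ).length = μ.length + 1 := by
  refine eq_of_forall_ge_iff fun c => ?_
  rw [Partn.length_le_iff]
  rcases c with - | c
  · have : (Partn.cons m μ).p 0 ≠ 0 := by
      change max m (μ.p 0) ≠ 0
      omega
    simp [this]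
  · rw [Partn.cons_p_succ, Nat.add_le_add_iff_right, Partn.length_le_iff]

/-- The partitions with at most `N` parts, all of them at most `n`. -/
noncomputable def boundedPartns : ℕ → ℕ → Finset Partn
  | 0, _ => {Partn.zero}
  | N + 1, n => (range (n + 1)).biUnion fun m => (boundedPartns N m).image (Partn.cons m)

theorem mem_boundedPartns {N n : ℕ} {ν : Partn} :
    ν ∈ boundedPartns N n ↔ ν.p 0 ≤ n ∧ ν.length ≤ N := by
  induction N generalizing n ν with
  | zero =>
    rw [boundedPartns, mem_singleton, Partn.length_le_iff]
    constructor
    · rintro rfl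
      exact ⟨Nat.zero_le n, rfl⟩
    · rintro ⟨-, h⟩
      exact Partn.p_injective <| funext fun i =>
        Nat.eq_zero_of_le_zero ((ν.antitone' i.zero_le).trans_eq h)
  | succ N ih =>
    simp only [boundedPartns, mem_biUnion, mem_image, mem_range, ih]
    constructor
    · rintro ⟨m, hm, μ, ⟨h1, h2⟩, rfl⟩
      rw [Partn.cons_p_zero h1, Partn.length_le_iff, Partn.cons_p_succ, ← Partn.length_le_iff]
      exact ⟨by omega, h2⟩
    · rintro ⟨h1, h2⟩
      obtain ⟨μ, hμ, h⟩ := ν.exists_eq_cons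
      rw [h, Partn.length_le_iff, Partn.cons_p_succ, ← Partn.length_le_iff] at h2
      exact ⟨ν.p 0, by omega, μ, ⟨hμ, h2⟩, h.symm⟩

theorem sum_boundedPartns_succ {M : Type*} [AddCommMonoid M] (N n : ℕ) (f : Partn → M) :
    ∑ ν ∈ boundedPartns (N + 1) n, f ν =
      ∑ m ∈ range (n + 1), ∑ μ ∈ boundedPartns N m, f (Partn.cons m μ) := by
  rw [boundedPartns, sum_biUnion]
  · exact sum_congr rfl fun m _ => sum_image fun _ _ _ _ h => Partn.cons_injective m h
  · intro m _ m' _ hne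
    refine disjoint_left.2 fun ν h h' => hne ?_
    obtain ⟨μ, hμ, rfl⟩ := mem_image.1 h
    obtain ⟨μ', hμ', h⟩ := mem_image.1 h'
    rw [← Partn.cons_p_zero (mem_boundedPartns.1 hμ).1, ← h,
      Partn.cons_p_zero (mem_boundedPartns.1 hμ').1]

end Partitions

section CauchySum

open Finset

theorem schurMultiset_val (ν : Partn) (E : Finset ℂ) :
    schurMultiset ν E.val = jacobiTrudi E ν.length ν.p := by
  simp only [schurMultiset, schurPoly, hsymm_toList, jacobiTrudi]

theorem jacobiTrudi_eq_zero {E : Finset ℂ} (hE : 0 ∉ E) {n : ℕ} {p : ℕ → ℕ}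
    (hp : ∀ i < n, 0 < p i) (hn : #E < n) : jacobiTrudi E n p = 0 := by
  induction n generalizing E p with
  | zero => omega
  | succ n ih =>
    rcases E.eq_empty_or_nonempty with rfl | hne
    · have h0 := hp 0 n.succ_pos
      refine Matrix.det_eq_zero_of_row_eq_zero 0 fun j => ?_
      rw [Matrix.of_apply, hFin_empty]
      simp only [Fin.val_zero]
      omega
    · rw [jacobiTrudi_succ hE hne]
      refine sum_eq_zero fun a ha => ?_
      rw [ih (fun h => hE (mem_of_mem_erase h)) (fun i hi => hp (i + 1) (by omega)), mul_zero]
      rw [card_erase_of_mem ha]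
      have := hne.card_pos
      omega

theorem schurMultiset_eq_zero {E : Finset ℂ} (hE : 0 ∉ E) {ν : Partn} (hν : #E < ν.length) :
    schurMultiset ν E.val = 0 := by
  rw [schurMultiset_val]
  refine jacobiTrudi_eq_zero hE (fun i hi => Nat.pos_of_ne_zero fun h => ?_) hν
  exact absurd ((ν.length_le_iff i).2 h) (not_le.2 hi)

theorem schurMultiset_of_length_eq_zero {E : Finset ℂ} {ν : Partn} (hν : ν.length = 0) :
    schurMultiset ν E.val = 1 := by
  rw [schurMultiset_val, hν, jacobiTrudi, Matrix.det_fin_zero]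

theorem schurMultiset_cons {E : Finset ℂ} (hE : 0 ∉ E) (hne : E.Nonempty) {m : ℕ} {μ : Partn}
    (h : μ.p 0 ≤ m) :
    schurMultiset (Partn.cons m μ) E.val =
      ∑ a ∈ E, nodeWeight E id a * a ^ m * schurMultiset μ (E.erase a).val := by
  rcases eq_or_ne m 0 with rfl | hm
  · have h1 : (Partn.cons 0 μ).length = 0 := by
      rw [← Nat.le_zero, Partn.length_le_iff, Partn.cons_p_zero h]
    have h2 : μ.length = 0 := by
      rw [← Nat.le_zero, Partn.length_le_iff]
      omega
    rw [schurMultiset_of_length_eq_zero h1, ← sum_nodeWeight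
      (Function.injective_id.injOn (s := (E : Set ℂ))) (fun i hi h => hE (h ▸ hi)) hne]
    simp only [schurMultiset_of_length_eq_zero h2, pow_zero, mul_one]
  · simp only [schurMultiset_val, Partn.length_cons hm]
    rw [jacobiTrudi_succ hE hne, Partn.cons_p_zero h]
    rfl

theorem sum_boundedPartns_zero_parts (n : ℕ) (E F : Finset ℂ) :
    ∑ ν ∈ boundedPartns 0 n, schurMultiset ν E.val * schurMultiset ν F.val = 1 := by
  have h : Partn.zero.length = 0 := by rw [← Nat.le_zero, Partn.length_le_iff]; rfl
  rw [boundedPartns, sum_singleton, schurMultiset_of_length_eq_zero h,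
    schurMultiset_of_length_eq_zero h, mul_one]

theorem sum_boundedPartns_eq_zero_parts (N n : ℕ) {f : Partn → ℂ}
    (hf : ∀ ν : Partn, 0 < ν.length → f ν = 0) :
    ∑ ν ∈ boundedPartns N n, f ν = ∑ ν ∈ boundedPartns 0 n, f ν := by
  symm
  refine sum_subset (fun ν hν => ?_) fun ν h1 h2 => hf ν (Nat.pos_of_ne_zero fun h => h2 ?_)
  · rw [mem_boundedPartns] at hν ⊢
    exact ⟨hν.1, hν.2.trans N.zero_le⟩
  · exact mem_boundedPartns.2 ⟨(mem_boundedPartns.1 h1).1, h.le⟩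

/-- Splitting off the largest part of each partition in a Cauchy sum. -/
theorem sum_boundedPartns_cons {A B : Finset ℂ} (hA : 0 ∉ A) (hB : 0 ∉ B) (hAne : A.Nonempty)
    (hBne : B.Nonempty) (N m : ℕ) :
    ∑ μ ∈ boundedPartns N m,
        schurMultiset (Partn.cons m μ) A.val * schurMultiset (Partn.cons m μ) B.val =
      ∑ a ∈ A, ∑ b ∈ B, nodeWeight A id a * nodeWeight B id b * (a * b) ^ m *
        ∑ μ ∈ boundedPartns N m,
          schurMultiset μ (A.erase a).val * schurMultiset μ (B.erase b).val := by
  simp only [mul_sum]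
  rw [sum_congr rfl fun a _ => sum_comm, sum_comm]
  refine sum_congr rfl fun μ hμ => ?_
  have h := (mem_boundedPartns.1 hμ).1
  rw [schurMultiset_cons hA hAne h, schurMultiset_cons hB hBne h, sum_mul_sum]
  refine sum_congr rfl fun a _ => sum_congr rfl fun b _ => ?_
  rw [mul_pow]
  ring

theorem sum_boundedPartns_eq_rectSum {A B : Finset ℂ} (hA : 0 ∉ A) (hB : 0 ∉ B)
    (hAB : ∀ a ∈ A, ∀ b ∈ B, a * b ≠ 1) (n : ℕ) {N : ℕ} (hN : #A ≤ N) :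
    ∑ ν ∈ boundedPartns N n, schurMultiset ν A.val * schurMultiset ν B.val = rectSum n A B := by
  induction N generalizing A B n with
  | zero =>
    obtain rfl : A = ∅ := card_eq_zero.1 (by omega)
    rw [sum_boundedPartns_zero_parts, rectSum_empty_left]
  | succ N ih =>
    rcases A.eq_empty_or_nonempty with rfl | hAne
    · rw [sum_boundedPartns_eq_zero_parts, sum_boundedPartns_zero_parts, rectSum_empty_left]
      intro ν hν
      rw [schurMultiset_eq_zero hA (by simpa using hν), zero_mul]
    rcases B.eq_empty_or_nonempty with rfl | hBne
    · rw [sum_boundedPartns_eq_zero_parts, sum_boundedPartns_zero_parts, rectSum_empty_right]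
      intro ν hν
      rw [schurMultiset_eq_zero hB (by simpa using hν), mul_zero]
    have step : ∀ m, ∑ μ ∈ boundedPartns N m,
        schurMultiset (Partn.cons m μ) A.val * schurMultiset (Partn.cons m μ) B.val =
      ∑ a ∈ A, ∑ b ∈ B, nodeWeight A id a * nodeWeight B id b * (a * b) ^ m *
        rectSum m (A.erase a) (B.erase b) := by
      intro m
      rw [sum_boundedPartns_cons hA hB hAne hBne]
      refine sum_congr rfl fun a ha => sum_congr rfl fun b _ => ?_
      rw [ih (fun h => hA (mem_of_mem_erase h)) (fun h => hB (mem_of_mem_erase h))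
        (fun a ha b hb => hAB a (mem_of_mem_erase ha) b (mem_of_mem_erase hb))]
      rw [card_erase_of_mem ha]
      omega
    rw [sum_boundedPartns_succ, sum_congr rfl fun m _ => step m]
    induction n with
    | zero =>
      have hr : ∀ a b, rectSum 0 (A.erase a) (B.erase b) = 1 := fun a b =>
        rectSum_zero (fun h => hA (mem_of_mem_erase h)) (fun h => hB (mem_of_mem_erase h))
          fun a ha b hb => hAB a (mem_of_mem_erase ha) b (mem_of_mem_erase hb)
      have hwA := sum_nodeWeight (Function.injective_id.injOn (s := (A : Set ℂ)))
        (fun i hi h => hA (h ▸ hi)) hAne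
      have hwB := sum_nodeWeight (Function.injective_id.injOn (s := (B : Set ℂ)))
        (fun i hi h => hB (h ▸ hi)) hBne
      simp only [zero_add, sum_range_one, hr, pow_zero, mul_one]
      rw [← sum_mul_sum, hwA, hwB, rectSum_zero hA hB hAB, mul_one]
    | succ n ihn => rw [sum_range_succ, ihn, rectSum_succ hA hB hAB]

theorem Zfac_eq_crossKernel (A B U V : Finset ℂ) :
    Zfac (A.val - U.val + minv V.val) (B.val - V.val + minv U.val) =
      crossKernel (A \ U) U (B \ V) V := by
  rw [← sdiff_val, ← sdiff_val]
  simp only [Zfac, minv, Multiset.map_add, Multiset.prod_add, Multiset.map_map,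
    Function.comp_def, crossKernel]
  change (∏ a ∈ A \ U, ((∏ b ∈ B \ V, (1 - a * b)⁻¹) * ∏ u ∈ U, (1 - a * u⁻¹)⁻¹)) *
    (∏ v ∈ V, ((∏ b ∈ B \ V, (1 - v⁻¹ * b)⁻¹) * ∏ u ∈ U, (1 - v⁻¹ * u⁻¹)⁻¹)) = _
  rw [prod_mul_distrib, prod_mul_distrib]
  ring

theorem mpow_val (U V : Finset ℂ) (m : ℕ) :
    mpow U.val V.val m = (∏ u ∈ U, u) ^ m * (∏ v ∈ V, v) ^ m := by
  rw [← prod_pow, ← prod_pow]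
  rfl

theorem finsum_eq_sum_boundedPartns {A B : Finset ℂ} (hA : 0 ∉ A) (x : ℂ) (n : ℕ) {N : ℕ}
    (hN : #A ≤ N) :
    ∑ᶠ ν : {ν : Partn // ν.p 0 ≤ n},
        x ^ ν.1.p 0 * schurMultiset ν.1 A.val * schurMultiset ν.1 B.val =
      ∑ ν ∈ boundedPartns N n,
        x ^ ν.p 0 * (schurMultiset ν A.val * schurMultiset ν B.val) := by
  simp only [← mul_assoc]
  refine (finsum_set_coe_eq_finsum_mem (s := {ν : Partn | ν.p 0 ≤ n})
    (f := fun ν => x ^ ν.p 0 * schurMultiset ν A.val * schurMultiset ν B.val)).trans ?_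
  refine finsum_mem_eq_sum_of_inter_support_eq _ ?_
  ext ν
  simp only [Set.mem_inter_iff, Set.mem_ofPred_eq, mem_coe, mem_boundedPartns, Function.mem_support]
  constructor
  · rintro ⟨h1, h2⟩
    refine ⟨⟨h1, ?_⟩, h2⟩
    by_contra! h
    exact h2 (by rw [schurMultiset_eq_zero hA (hN.trans_lt h), mul_zero, zero_mul])
  · rintro ⟨⟨h1, -⟩, h2⟩
    exact ⟨h1, h2⟩

end CauchySum

/-- Lemma on partial Cauchy sums with a geometric factor `x^{ν₁}`. -/
theorem partial_cauchy_with_extra_factor (A B : Finset ℂ)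
    (hAne : A.Nonempty) (hBne : B.Nonempty)
    (hA0 : (0:ℂ) ∉ A) (hB0 : (0:ℂ) ∉ B)
    (hAB : Disjoint A B)
    (hAiA : Disjoint A (A.image (·⁻¹)))
    (hAiB : Disjoint A (B.image (·⁻¹)))
    (hBiA : Disjoint B (A.image (·⁻¹)))
    (hBiB : Disjoint B (B.image (·⁻¹)))
    (hiAiB : Disjoint (A.image (·⁻¹)) (B.image (·⁻¹)))
    (x : ℂ) (n : ℕ) :
    ∑ᶠ ν : {ν : Partn // ν.p 0 ≤ n},
        x ^ ν.1.p 0 * schurMultiset ν.1 A.val * schurMultiset ν.1 B.val =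
      ∑ a ∈ A, ∑ b ∈ B,
        (∏ a' ∈ A.erase a, (1 - a' / a)⁻¹) * (∏ b' ∈ B.erase b, (1 - b' / b)⁻¹) *
          ∑ m ∈ Finset.range (n + 1), (x * a * b) ^ m *
            ∑ U ∈ (A.erase a).powerset,
              ∑ V ∈ (B.erase b).powerset.filter (fun V => V.card = U.card),
                mpow U.val V.val m *
                  Zfac ((A.erase a).val - U.val + minv V.val)
                    ((B.erase b).val - V.val + minv U.val) := by
  have hAB1 : ∀ a ∈ A, ∀ b ∈ B, a * b ≠ 1 := fun a ha b hb h =>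
    Finset.disjoint_left.1 hAiB ha
      (Finset.mem_image.2 ⟨b, hb, (eq_inv_of_mul_eq_one_left h).symm⟩)
  rw [finsum_eq_sum_boundedPartns hA0 x n A.card.le_succ, sum_boundedPartns_succ]
  have step : ∀ m, ∑ μ ∈ boundedPartns A.card m, x ^ (Partn.cons m μ).p 0 *
        (schurMultiset (Partn.cons m μ) A.val * schurMultiset (Partn.cons m μ) B.val) =
      ∑ a ∈ A, ∑ b ∈ B, nodeWeight A id a * nodeWeight B id b *
        ((x * a * b) ^ m * rectSum m (A.erase a) (B.erase b)) := by
    intro m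
    rw [Finset.sum_congr rfl fun μ hμ => by
      rw [Partn.cons_p_zero (mem_boundedPartns.1 hμ).1], ← Finset.mul_sum,
      sum_boundedPartns_cons hA0 hB0 hAne hBne, Finset.mul_sum]
    refine Finset.sum_congr rfl fun a ha => ?_
    rw [Finset.mul_sum]
    refine Finset.sum_congr rfl fun b _ => ?_
    rw [sum_boundedPartns_eq_rectSum (fun h => hA0 (Finset.mem_of_mem_erase h))
      (fun h => hB0 (Finset.mem_of_mem_erase h))
      (fun a ha b hb => hAB1 a (Finset.mem_of_mem_erase ha) b (Finset.mem_of_mem_erase hb)) m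
      (Finset.card_le_card (Finset.erase_subset a A))]
    simp only [mul_pow]
    ring
  rw [Finset.sum_congr rfl fun m _ => step m, Finset.sum_comm]
  refine Finset.sum_congr rfl fun a _ => ?_
  rw [Finset.sum_comm]
  refine Finset.sum_congr rfl fun b _ => ?_
  rw [← Finset.mul_sum]
  simp only [Zfac_eq_crossKernel, mpow_val]
  rfl
end

section
/- Let L and K be positive integers, let τ = (τ₁,…,τ_{L+K}) be a partition, and set γ = (τ₁,…,τ_L) and δ = (τ_{L+1},…,τ_{L+K}). Let x₁,…,x_{L+K} be pairwise distinct complex numbers. Let Ξ_{L,K} denote the set of permutations σ of {1,…,L+K} with σ(1) < σ(2) < … < σ(L) and σ(L+1) < σ(L+2) < … < σ(L+K), and let γ + ⟨K^L⟩ denote the partition (τ₁+K,…,τ_L+K). Then s_τ(x₁,…,x_{L+K}) = Σ_{σ∈Ξ_{L,K}} ∏_{1≤ℓ≤L, 1≤k≤K} (x_{σ(ℓ)} − x_{σ(L+k)})^{−1} · s_{γ+⟨K^L⟩}(x_{σ(1)},…,x_{σ(L)}) · s_δ(x_{σ(L+1)},…,x_{σ(L+K)}). -/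
open scoped Classical

/-- The Schur polynomial `s_ρ(x₁,…,x_k)` of a partition given as a weakly decreasing
tuple `ρ : Fin m → ℕ` (trailing zeros are harmless), via the Jacobi–Trudi formula. -/
noncomputable def schurTuple {m k : ℕ} (ρ : Fin m → ℕ) (x : Fin k → ℂ) : ℂ :=
  Matrix.det (Matrix.of fun i j : Fin m => hsymm k ((ρ i : ℤ) - (i : ℤ) + (j : ℤ)) x)

/-- The numerator of Jacobi's bialternant formula. -/
noncomputable def alternant {k : ℕ} (ρ : Fin k → ℕ) (x : Fin k → ℂ) : ℂ :=
  Matrix.det (Matrix.of fun p i : Fin k => x p ^ (ρ i + (i.rev : ℕ)))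

theorem hsymm_natCast (k n : ℕ) (x : Fin k → ℂ) :
    hsymm k n x = PowerSeries.coeff n (∏ i, PowerSeries.mk fun m => x i ^ m) := by
  simp only [hsymm, Int.natCast_nonneg, if_true, Int.toNat_natCast, PowerSeries.coeff_prod,
    PowerSeries.coeff_mk]
  refine Finset.sum_bij' (fun c _ => Finsupp.equivFunOnFinite.symm c) (fun l _ => l) ?_ ?_ ?_ ?_ ?_
  · simp [Finset.Nat.mem_antidiagonalTuple]
  · simp [Finset.Nat.mem_antidiagonalTuple]
  · simp
  · intro a _
    ext
    simp
  · simp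

theorem hsymm_of_neg (k : ℕ) {m : ℤ} (hm : m < 0) (x : Fin k → ℂ) : hsymm k m x = 0 := by
  simp [hsymm, hm]

theorem hsymm_zero (k : ℕ) (x : Fin k → ℂ) : hsymm k 0 x = 1 := by
  have h := hsymm_natCast k 0 x
  rw [Nat.cast_zero] at h
  rw [h, PowerSeries.coeff_zero_eq_constantCoeff, map_prod]
  exact Finset.prod_eq_one fun i _ => by
    rw [← PowerSeries.coeff_zero_eq_constantCoeff, PowerSeries.coeff_mk, pow_zero]

theorem mk_pow_mul_one_sub (a : ℂ) :
    (PowerSeries.mk fun m => a ^ m) * (1 - Polynomial.C a * Polynomial.X : Polynomial ℂ) = 1 := by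
  have h := congrArg (PowerSeries.rescale a) (PowerSeries.mk_one_mul_one_sub_eq_one ℂ)
  simpa [PowerSeries.rescale_mk, PowerSeries.rescale_X] using h

/-- The generating polynomial, up to signs, of the elementary symmetric polynomials in the
variables other than `x p`. -/
noncomputable def cofactorPoly {k : ℕ} (x : Fin k → ℂ) (p : Fin k) : Polynomial ℂ :=
  ∏ q ∈ Finset.univ.erase p, (1 - Polynomial.C (x q) * Polynomial.X)

theorem natDegree_cofactorPoly_lt {k : ℕ} (x : Fin k → ℂ) (p : Fin k) :
    (cofactorPoly x p).natDegree < k := by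
  have hk : 0 < k := p.pos
  have h : (cofactorPoly x p).natDegree ≤ ∑ q ∈ Finset.univ.erase p, 1 :=
    (Polynomial.natDegree_prod_le _ _).trans <| Finset.sum_le_sum fun q _ => by
      compute_degree
  simp at h
  omega

theorem mk_pow_eq_cofactorPoly_mul {k : ℕ} (x : Fin k → ℂ) (p : Fin k) :
    (PowerSeries.mk fun m => x p ^ m) =
      (cofactorPoly x p : PowerSeries ℂ) * ∏ i, PowerSeries.mk fun m => x i ^ m := by
  have h : (cofactorPoly x p : PowerSeries ℂ) *
      ∏ q ∈ Finset.univ.erase p, (PowerSeries.mk fun m => x q ^ m) = 1 := by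
    have hc : (cofactorPoly x p : PowerSeries ℂ) = ∏ q ∈ Finset.univ.erase p,
        ((1 - Polynomial.C (x q) * Polynomial.X : Polynomial ℂ) : PowerSeries ℂ) := by
      exact map_prod (Polynomial.coeToPowerSeries.ringHom (R := ℂ))
        (fun q => 1 - Polynomial.C (x q) * Polynomial.X) (Finset.univ.erase p)
    rw [hc, ← Finset.prod_mul_distrib]
    exact Finset.prod_eq_one fun q _ => by rw [mul_comm, mk_pow_mul_one_sub]
  rw [← Finset.mul_prod_erase _ _ (Finset.mem_univ p), mul_left_comm, h, mul_one]

theorem pow_eq_sum_hsymm_mul_coeff {k : ℕ} (x : Fin k → ℂ) (p : Fin k) (n : ℕ) :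
    x p ^ n = ∑ j : Fin k, hsymm k ((n : ℤ) - (j : ℤ)) x * (cofactorPoly x p).coeff j := by
  have h := congrArg (PowerSeries.coeff n) (mk_pow_eq_cofactorPoly_mul x p)
  rw [PowerSeries.coeff_mk, PowerSeries.coeff_mul, Finset.Nat.sum_antidiagonal_eq_sum_range_succ_mk]
    at h
  rw [h, Fin.sum_univ_eq_sum_range
    (fun j => hsymm k ((n : ℤ) - (j : ℤ)) x * (cofactorPoly x p).coeff j) k]
  have hterm : ∀ j ∈ Finset.range n.succ,
      PowerSeries.coeff j (cofactorPoly x p : PowerSeries ℂ) *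
        PowerSeries.coeff (n - j) (∏ i, PowerSeries.mk fun m => x i ^ m) =
      hsymm k ((n : ℤ) - (j : ℤ)) x * (cofactorPoly x p).coeff j := by
    intro j hj
    have hj' : j ≤ n := Nat.lt_succ_iff.mp (Finset.mem_range.mp hj)
    rw [← Nat.cast_sub hj', hsymm_natCast, Polynomial.coeff_coe, mul_comm]
  rw [Finset.sum_congr rfl hterm]
  rcases le_total n.succ k with hnk | hnk
  · refine Finset.sum_subset (Finset.range_mono hnk) fun j _ hj => ?_
    rw [hsymm_of_neg, zero_mul]
    simp at hj
    omega
  · refine (Finset.sum_subset (Finset.range_mono hnk) fun j _ hj => ?_).symm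
    rw [Polynomial.coeff_eq_zero_of_natDegree_lt, mul_zero]
    simp at hj
    exact (natDegree_cofactorPoly_lt x p).trans_le hj

theorem alternant_eq_schurTuple_mul_det {k : ℕ} (ρ : Fin k → ℕ) (x : Fin k → ℂ) :
    alternant ρ x = schurTuple ρ x *
      Matrix.det (Matrix.of fun j p : Fin k => (cofactorPoly x p).coeff j.rev) := by
  rw [alternant, schurTuple, ← Matrix.det_mul, ← Matrix.det_transpose]
  congr 1
  ext i p
  simp only [Matrix.transpose_apply, Matrix.of_apply, Matrix.mul_apply]
  rw [pow_eq_sum_hsymm_mul_coeff, ← Equiv.sum_comp Fin.revPerm]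
  refine Finset.sum_congr rfl fun j _ => ?_
  simp only [Fin.revPerm_apply]
  congr 2
  simp only [Fin.val_rev]
  omega

theorem schurTuple_zero {k : ℕ} (x : Fin k → ℂ) : schurTuple (0 : Fin k → ℕ) x = 1 := by
  rw [schurTuple, Matrix.det_of_isUpperTriangular]
  · exact Finset.prod_eq_one fun i _ => by simp [hsymm_zero]
  · intro i j hij
    exact hsymm_of_neg k (by simp at hij ⊢; omega) x

/-- The Jacobi–Trudi determinant agrees with Jacobi's bialternant quotient. -/
theorem alternant_eq_schurTuple_mul {k : ℕ} (ρ : Fin k → ℕ) (x : Fin k → ℂ) :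
    alternant ρ x = schurTuple ρ x * alternant 0 x := by
  rw [alternant_eq_schurTuple_mul_det, alternant_eq_schurTuple_mul_det 0, schurTuple_zero, one_mul]

theorem alternant_zero_eq_prod {k : ℕ} (x : Fin k → ℂ) :
    alternant 0 x = ∏ i, ∏ j, if i < j then x i - x j else 1 := by
  have h := Matrix.det_projVandermonde (fun _ : Fin k => (1 : ℂ)) x
  have hm : Matrix.projVandermonde (fun _ : Fin k => (1 : ℂ)) x =
      Matrix.of fun p i : Fin k => x p ^ ((0 : Fin k → ℕ) i + (i.rev : ℕ)) := by
    ext p i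
    simp [Matrix.projVandermonde_apply]
  rw [alternant, ← hm, h]
  refine Finset.prod_congr rfl fun i _ => ?_
  rw [← Finset.prod_filter]
  refine Finset.prod_congr (by ext; simp) fun j _ => by ring

theorem alternant_zero_ne_zero {k : ℕ} {x : Fin k → ℂ} (hx : Function.Injective x) :
    alternant 0 x ≠ 0 := by
  rw [alternant_zero_eq_prod]
  refine Finset.prod_ne_zero_iff.mpr fun i _ => Finset.prod_ne_zero_iff.mpr fun j _ => ?_
  split_ifs with hij
  · exact sub_ne_zero.mpr (hx.ne hij.ne)
  · exact one_ne_zero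

theorem alternant_comp_perm {k : ℕ} (ρ : Fin k → ℕ) (x : Fin k → ℂ) (σ : Equiv.Perm (Fin k)) :
    alternant ρ (x ∘ σ) = (Equiv.Perm.sign σ : ℤ) * alternant ρ x :=
  Matrix.det_permute σ (Matrix.of fun p i : Fin k => x p ^ (ρ i + (i.rev : ℕ)))

theorem alternant_zero_add (L K : ℕ) (x : Fin (L + K) → ℂ) :
    alternant 0 x = (∏ l : Fin L, ∏ k : Fin K, (x (Fin.castAdd K l) - x (Fin.natAdd L k))) *
      (alternant 0 (x ∘ Fin.castAdd K) * alternant 0 (x ∘ Fin.natAdd L)) := by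
  have h₁ : ∀ (l : Fin L) (k : Fin K), Fin.castAdd K l < Fin.natAdd L k := fun l k => by
    simp only [Fin.lt_def, Fin.val_castAdd, Fin.val_natAdd]
    omega
  have h₂ : ∀ (l : Fin L) (k : Fin K), ¬ Fin.natAdd L k < Fin.castAdd K l := fun l k =>
    (h₁ l k).le.not_gt
  have h₃ : ∀ l l' : Fin L, Fin.castAdd K l < Fin.castAdd K l' ↔ l < l' := fun _ _ => Iff.rfl
  have h₄ : ∀ k k' : Fin K, Fin.natAdd L k < Fin.natAdd L k' ↔ k < k' := fun k k' => by
    simp only [Fin.lt_def, Fin.val_natAdd, add_lt_add_iff_left]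
  simp only [alternant_zero_eq_prod, Fin.prod_univ_add, h₁, h₂, h₃, h₄, if_true, if_false,
    Finset.prod_const_one, Finset.prod_mul_distrib, Function.comp_apply]
  ring

/-- A permutation that is increasing on the first `L` and on the last `K` positions. -/
def IsShuffle (L K : ℕ) (σ : Equiv.Perm (Fin (L + K))) : Prop :=
  (∀ i j : Fin (L + K), (i : ℕ) < L → (j : ℕ) < L → i < j → σ i < σ j) ∧
    (∀ i j : Fin (L + K), L ≤ (i : ℕ) → L ≤ (j : ℕ) → i < j → σ i < σ j)

theorem isShuffle_iff {L K : ℕ} {σ : Equiv.Perm (Fin (L + K))} :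
    IsShuffle L K σ ↔ StrictMono (σ ∘ Fin.castAdd K) ∧ StrictMono (σ ∘ Fin.natAdd L) := by
  refine and_congr ⟨fun h l l' hl => h _ _ (by simp) (by simp) hl, fun h i j => ?_⟩
    ⟨fun h k k' hk => h _ _ (by simp) (by simp) ((Fin.strictMono_natAdd L) hk), fun h i j => ?_⟩
  · refine Fin.addCases (fun l => ?_) (fun k => ?_) i
    · refine Fin.addCases (fun l' => ?_) (fun k' => ?_) j
      · exact fun _ _ hl => h hl
      · intro _ hk
        simp at hk
    · intro hk
      simp at hk
  · refine Fin.addCases (fun l => ?_) (fun k => ?_) i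
    · intro hl
      simp at hl
      omega
    · refine Fin.addCases (fun l' => ?_) (fun k' => ?_) j
      · intro _ hl
        simp at hl
        omega
      · exact fun _ _ hk => h ((Fin.strictMono_natAdd L).lt_iff_lt.1 hk)

/-- Permute the first `L` and the last `K` positions separately. -/
def blockPerm {L K : ℕ} (a : Equiv.Perm (Fin L)) (b : Equiv.Perm (Fin K)) :
    Equiv.Perm (Fin (L + K)) :=
  finSumFinEquiv.permCongr (Equiv.Perm.sumCongr a b)

@[simp]
theorem blockPerm_castAdd {L K : ℕ} (a : Equiv.Perm (Fin L)) (b : Equiv.Perm (Fin K))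
    (l : Fin L) : blockPerm a b (Fin.castAdd K l) = Fin.castAdd K (a l) := by
  simp [blockPerm, Equiv.permCongr_apply]

@[simp]
theorem blockPerm_natAdd {L K : ℕ} (a : Equiv.Perm (Fin L)) (b : Equiv.Perm (Fin K))
    (k : Fin K) : blockPerm a b (Fin.natAdd L k) = Fin.natAdd L (b k) := by
  simp [blockPerm, Equiv.permCongr_apply]

theorem sign_blockPerm {L K : ℕ} (a : Equiv.Perm (Fin L)) (b : Equiv.Perm (Fin K)) :
    Equiv.Perm.sign (blockPerm a b) = Equiv.Perm.sign a * Equiv.Perm.sign b := by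
  rw [blockPerm, Equiv.Perm.sign_permCongr, Equiv.Perm.sign_sumCongr]

theorem blockPerm_mul_blockPerm_inv {L K : ℕ} (a : Equiv.Perm (Fin L)) (b : Equiv.Perm (Fin K)) :
    blockPerm a b * blockPerm a⁻¹ b⁻¹ = 1 := by
  ext i
  refine Fin.addCases (fun l => ?_) (fun k => ?_) i <;> simp

/-- Each permutation factors uniquely as a shuffle times a block permutation. -/
theorem sum_shuffle_mul_blockPerm {M : Type*} [AddCommMonoid M] (L K : ℕ)
    (f : Equiv.Perm (Fin (L + K)) → M) :
    ∑ σ ∈ Finset.univ.filter (IsShuffle L K), ∑ a, ∑ b, f (σ * blockPerm a b) = ∑ π, f π := by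
  simp only [← Finset.sum_product']
  refine Finset.sum_bij (fun s _ => s.1 * blockPerm s.2.1 s.2.2) (fun _ _ => Finset.mem_univ _)
    ?_ ?_ (fun _ _ => rfl)
  · rintro ⟨σ, a, b⟩ hs ⟨σ', a', b'⟩ hs' h
    simp only [Finset.mem_product, Finset.mem_filter, Finset.mem_univ, true_and, and_true,
      isShuffle_iff] at hs hs'
    have hl : ∀ l, σ (Fin.castAdd K (a l)) = σ' (Fin.castAdd K (a' l)) := fun l => by
      simpa using Equiv.congr_fun h (Fin.castAdd K l)
    have hk : ∀ k, σ (Fin.natAdd L (b k)) = σ' (Fin.natAdd L (b' k)) := fun k => by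
      simpa using Equiv.congr_fun h (Fin.natAdd L k)
    have el : σ ∘ Fin.castAdd K = σ' ∘ Fin.castAdd K := by
      rw [← hs.1.range_inj hs'.1, ← a.surjective.range_comp (σ ∘ Fin.castAdd K),
        ← a'.surjective.range_comp (σ' ∘ Fin.castAdd K)]
      exact congrArg Set.range (funext hl)
    have ek : σ ∘ Fin.natAdd L = σ' ∘ Fin.natAdd L := by
      rw [← hs.2.range_inj hs'.2, ← b.surjective.range_comp (σ ∘ Fin.natAdd L),
        ← b'.surjective.range_comp (σ' ∘ Fin.natAdd L)]
      exact congrArg Set.range (funext hk)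
    obtain rfl : σ = σ' := Equiv.ext fun i =>
      Fin.addCases (fun l => congrFun el l) (fun k => congrFun ek k) i
    obtain rfl : a = a' := Equiv.ext fun l => hs.1.injective (hl l)
    obtain rfl : b = b' := Equiv.ext fun k => hs.2.injective (hk k)
    rfl
  · intro π _
    set a := Tuple.sort (π ∘ Fin.castAdd K)
    set b := Tuple.sort (π ∘ Fin.natAdd L)
    refine ⟨(π * blockPerm a b, a⁻¹, b⁻¹), ?_, ?_⟩
    · simp only [Finset.mem_product, Finset.mem_filter, Finset.mem_univ, true_and, and_true,
        isShuffle_iff]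
      constructor
      · have h := (Tuple.monotone_sort (π ∘ Fin.castAdd K)).strictMono_of_injective
          ((π.injective.comp (Fin.castAdd_injective L K)).comp a.injective)
        convert h using 1
        ext l
        simp [a]
      · have h := (Tuple.monotone_sort (π ∘ Fin.natAdd L)).strictMono_of_injective
          ((π.injective.comp (Fin.natAdd_injective K L)).comp b.injective)
        convert h using 1
        ext k
        simp [b]
    · simp only [mul_assoc, blockPerm_mul_blockPerm_inv, mul_one]

/-- Laplace expansion of a determinant along the first `L` columns. -/
theorem det_eq_sum_shuffle {R : Type*} [CommRing R] (L K : ℕ)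
    (A : Matrix (Fin (L + K)) (Fin (L + K)) R) :
    A.det = ∑ σ ∈ Finset.univ.filter (IsShuffle L K), (Equiv.Perm.sign σ : ℤ) *
      ((A.submatrix (σ ∘ Fin.castAdd K) (Fin.castAdd K)).det *
        (A.submatrix (σ ∘ Fin.natAdd L) (Fin.natAdd L)).det) := by
  rw [Matrix.det_apply', ← sum_shuffle_mul_blockPerm]
  refine Finset.sum_congr rfl fun σ _ => ?_
  rw [Matrix.det_apply', Matrix.det_apply', Finset.sum_mul_sum, Finset.mul_sum]
  refine Finset.sum_congr rfl fun a _ => ?_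
  rw [Finset.mul_sum]
  refine Finset.sum_congr rfl fun b _ => ?_
  simp only [Fin.prod_univ_add, Equiv.Perm.sign_mul, sign_blockPerm, Equiv.Perm.mul_apply,
    blockPerm_castAdd, blockPerm_natAdd, Matrix.submatrix_apply, Function.comp_apply]
  push_cast
  ring

theorem alternant_eq_sum_shuffle (L K : ℕ) (τ : Fin (L + K) → ℕ) (x : Fin (L + K) → ℂ) :
    alternant τ x = ∑ σ ∈ Finset.univ.filter (IsShuffle L K), (Equiv.Perm.sign σ : ℤ) *
      (alternant (fun l : Fin L => τ (Fin.castAdd K l) + K) (x ∘ σ ∘ Fin.castAdd K) *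
        alternant (fun k : Fin K => τ (Fin.natAdd L k)) (x ∘ σ ∘ Fin.natAdd L)) := by
  rw [alternant, det_eq_sum_shuffle]
  refine Finset.sum_congr rfl fun σ _ => ?_
  congr 3
  · ext p l
    simp only [Matrix.submatrix_apply, Matrix.of_apply, Function.comp_apply, Fin.val_rev,
      Fin.val_castAdd]
    congr 1
    omega
  · ext p k
    simp only [Matrix.submatrix_apply, Matrix.of_apply, Function.comp_apply, Fin.val_rev,
      Fin.val_natAdd]
    congr 1
    omega

/-- **Cofactor expansion of the Schur polynomial** (Lemma 4.1 / Bump–Gamburd):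
for a partition `τ = (τ₁,…,τ_{L+K})`, with `γ = (τ₁,…,τ_L)`, `δ = (τ_{L+1},…,τ_{L+K})`,
and pairwise distinct `x₁,…,x_{L+K}`,
`s_τ(x) = Σ_{σ∈Ξ_{L,K}} ∏_{ℓ,k} (x_{σ(ℓ)} − x_{σ(L+k)})⁻¹
  s_{γ+⟨K^L⟩}(x_{σ(1)},…,x_{σ(L)}) s_δ(x_{σ(L+1)},…,x_{σ(L+K)})`,
where `Ξ_{L,K}` is the set of permutations increasing on the first `L` and on the last
`K` positions. -/
theorem schur_cofactor_expansion (L K : ℕ) (hL : 0 < L) (hK : 0 < K)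
    (τ : Fin (L + K) → ℕ) (hτ : Antitone τ)
    (x : Fin (L + K) → ℂ) (hx : Function.Injective x) :
    schurTuple τ x =
      ∑ σ ∈ Finset.univ.filter (fun σ : Equiv.Perm (Fin (L + K)) =>
          (∀ i j : Fin (L + K), (i : ℕ) < L → (j : ℕ) < L → i < j → σ i < σ j) ∧
          (∀ i j : Fin (L + K), L ≤ (i : ℕ) → L ≤ (j : ℕ) → i < j → σ i < σ j)),
        (∏ l : Fin L, ∏ k : Fin K,
            (x (σ (Fin.castAdd K l)) - x (σ (Fin.natAdd L k)))⁻¹) *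
          schurTuple (fun l : Fin L => τ (Fin.castAdd K l) + K)
            (fun l : Fin L => x (σ (Fin.castAdd K l))) *
          schurTuple (fun k : Fin K => τ (Fin.natAdd L k))
            (fun k : Fin K => x (σ (Fin.natAdd L k))) := by
  refine mul_right_cancel₀ (alternant_zero_ne_zero hx) ?_
  rw [← alternant_eq_schurTuple_mul, alternant_eq_sum_shuffle, Finset.sum_mul]
  refine Finset.sum_congr (by ext; simp [IsShuffle]) fun σ _ => ?_
  have hsign : ((Equiv.Perm.sign σ : ℤ) : ℂ) * (Equiv.Perm.sign σ : ℤ) = 1 := by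
    norm_cast
    simp
  have hV : alternant 0 x = (Equiv.Perm.sign σ : ℤ) * alternant 0 (x ∘ σ) := by
    rw [alternant_comp_perm, ← mul_assoc, hsign, one_mul]
  have hne : ∏ l : Fin L, ∏ k : Fin K,
      (x (σ (Fin.castAdd K l)) - x (σ (Fin.natAdd L k))) ≠ 0 := by
    refine Finset.prod_ne_zero_iff.mpr fun l _ => Finset.prod_ne_zero_iff.mpr fun k _ =>
      sub_ne_zero.mpr ((hx.comp σ.injective).ne (Fin.ne_of_val_ne ?_))
    simp only [Fin.val_castAdd, Fin.val_natAdd]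
    omega
  rw [hV, alternant_zero_add, alternant_eq_schurTuple_mul _ (x ∘ σ ∘ Fin.castAdd K),
    alternant_eq_schurTuple_mul _ (x ∘ σ ∘ Fin.natAdd L)]
  simp only [Finset.prod_inv_distrib, Function.comp_def]
  field_simp
end

section
/- Let L and K be positive integers. For each pair of sets U ⊆ {1,…,L} and V ⊆ {1,…,K}, let f_{U,V}(x₁,…,x_L; y₁,…,y_K) be a complex-valued function that is entire in each of the variables x₁,…,x_L, y₁,…,y_K. Suppose there is a positive integer N₀ such that Σ_{U⊆{1,…,L}, V⊆{1,…,K}} (∏_{i∈U} x_i ∏_{j∈V} y_j)^N · f_{U,V}(x₁,…,x_L; y₁,…,y_K) = 0 for all integers N ≥ N₀ and all complex numbers x₁,…,x_L, y₁,…,y_K. Then f_{U,V} is identically zero for every pair U, V. -/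
/-- If a power sum with pairwise distinct nodes vanishes for all large exponents, every coefficient
at a nonzero node vanishes. -/
theorem eq_zero_of_forall_ge_sum_pow_mul_eq_zero {R ι : Type*} [CommRing R] [IsDomain R] [Fintype ι]
    {c h : ι → R} (hc : Function.Injective c) {n : ℕ}
    (hsum : ∀ N, n ≤ N → ∑ i, c i ^ N * h i = 0) {i : ι} (hi : c i ≠ 0) : h i = 0 := by
  classical
  have key (p : Polynomial R) : ∑ j, p.eval (c j) * (c j ^ n * h j) = 0 := by
    induction p using Polynomial.induction_on' with
    | add p q hp hq =>
      simp only [Polynomial.eval_add, add_mul, Finset.sum_add_distrib, hp, hq, add_zero]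
    | monomial m a =>
      rw [← mul_zero a, ← hsum (m + n) (Nat.le_add_left n m), Finset.mul_sum]
      refine Finset.sum_congr rfl fun j _ => ?_
      rw [Polynomial.eval_monomial]
      ring
  have hp := key (∏ k ∈ Finset.univ.erase i, (Polynomial.X - Polynomial.C (c k)))
  simp only [Polynomial.eval_prod, Polynomial.eval_sub, Polynomial.eval_X, Polynomial.eval_C] at hp
  rw [Finset.sum_eq_single i] at hp
  · have hprod : ∏ k ∈ Finset.univ.erase i, (c i - c k) ≠ 0 :=
      Finset.prod_ne_zero_iff.2 fun k hk =>
        sub_ne_zero.2 fun hik => Finset.ne_of_mem_erase hk (hc hik).symm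
    simpa [hprod, hi] using hp
  · intro j _ hj
    rw [Finset.prod_eq_zero (Finset.mem_erase.2 ⟨hj, Finset.mem_univ j⟩) (sub_self _), zero_mul]
  · simp

/-- The entries of `z` indexed by `T` are nonzero and have pairwise distinct subset products. -/
def HasDistinctSubsetProducts {ι : Type*} (T : Finset ι) (z : ι → ℂ) : Prop :=
  (∀ i ∈ T, z i ≠ 0) ∧ ∀ S₁ ⊆ T, ∀ S₂ ⊆ T, ∏ i ∈ S₁, z i = ∏ i ∈ S₂, z i → S₁ = S₂

/-- Only finitely many values of a new coordinate destroy distinctness of subset products. -/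
theorem HasDistinctSubsetProducts.exists_finset_update {ι : Type*} [DecidableEq ι] {T : Finset ι}
    {z : ι → ℂ} (hz : HasDistinctSubsetProducts T z) {a : ι} (ha : a ∉ T) :
    ∃ F : Finset ℂ, ∀ w ∉ F, HasDistinctSubsetProducts (insert a T) (Function.update z a w) := by
  let ratio : Finset ι × Finset ι → ℂ := fun S => (∏ i ∈ S.1, z i) / ∏ i ∈ S.2, z i
  refine ⟨insert 0 ((T.powerset ×ˢ T.powerset).image ratio), fun w hw => ?_⟩
  simp only [Finset.mem_insert, Finset.mem_image, Finset.mem_product, Finset.mem_powerset,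
    not_or, not_exists, not_and, Prod.forall] at hw
  obtain ⟨hw0, hw⟩ := hw
  have hne (S : Finset ι) (hS : S ⊆ T) : ∏ i ∈ S, z i ≠ 0 :=
    Finset.prod_ne_zero_iff.2 fun i hi => hz.1 i (hS hi)
  have hsub {S : Finset ι} (hS : S ⊆ insert a T) : S \ {a} ⊆ T := by
    rwa [Finset.sdiff_singleton_eq_erase, ← Finset.subset_insert_iff]
  have hmixed {S S' : Finset ι} (hS : S ⊆ T) (hS' : S' ⊆ T) :
      w * ∏ i ∈ S, z i ≠ ∏ i ∈ S', z i := fun h =>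
    hw S' S ⟨hS', hS⟩ ((eq_div_iff (hne S hS)).2 h).symm
  refine ⟨fun i hi => ?_, fun S₁ h₁ S₂ h₂ h => ?_⟩
  · obtain rfl | hi := Finset.mem_insert.1 hi
    · simpa using hw0
    · rw [Function.update_of_ne (ne_of_mem_of_not_mem hi ha)]
      exact hz.1 i hi
  · by_cases ha₁ : a ∈ S₁ <;> by_cases ha₂ : a ∈ S₂
    · rw [Finset.prod_update_of_mem ha₁, Finset.prod_update_of_mem ha₂] at h
      have h' := hz.2 _ (hsub h₁) _ (hsub h₂) (mul_left_cancel₀ hw0 h)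
      rw [Finset.sdiff_singleton_eq_erase, Finset.sdiff_singleton_eq_erase] at h'
      rw [← Finset.insert_erase ha₁, h', Finset.insert_erase ha₂]
    · rw [Finset.prod_update_of_mem ha₁, Finset.prod_update_of_notMem ha₂] at h
      exact absurd h (hmixed (hsub h₁) ((Finset.subset_insert_iff_of_notMem ha₂).1 h₂))
    · rw [Finset.prod_update_of_notMem ha₁, Finset.prod_update_of_mem ha₂] at h
      exact absurd h.symm (hmixed (hsub h₂) ((Finset.subset_insert_iff_of_notMem ha₁).1 h₁))
    · rw [Finset.prod_update_of_notMem ha₁, Finset.prod_update_of_notMem ha₂] at h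
      exact hz.2 _ ((Finset.subset_insert_iff_of_notMem ha₁).1 h₁) _
        ((Finset.subset_insert_iff_of_notMem ha₂).1 h₂) h

/-- A separately continuous function vanishing at all points with distinct subset products is
zero. -/
theorem eq_zero_of_forall_hasDistinctSubsetProducts {ι : Type*} [DecidableEq ι] {g : (ι → ℂ) → ℂ}
    (hg : ∀ z i, Continuous fun w => g (Function.update z i w)) (T : Finset ι)
    (h : ∀ z, HasDistinctSubsetProducts T z → g z = 0) (z : ι → ℂ) : g z = 0 := by
  induction T using Finset.induction_on with
  | empty =>
    exact h z ⟨by simp, fun S₁ h₁ S₂ h₂ _ =>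
      (Finset.subset_empty.1 h₁).trans (Finset.subset_empty.1 h₂).symm⟩
  | insert a T ha ih =>
    refine ih fun z hz => ?_
    obtain ⟨F, hF⟩ := hz.exists_finset_update ha
    have hzero := Continuous.ext_on (F.countable_toSet.dense_compl ℂ) (hg z a)
      (continuous_const (y := (0 : ℂ))) fun w hw => h _ (hF w (by simpa using hw))
    simpa using congrFun hzero (z a)

/-- **Lemma 7.1 (linear independence of exponentials).** If finitely many functions
`f_{U,V}`, indexed by pairs of subsets `U ⊆ {1,…,L}`, `V ⊆ {1,…,K}` and entire in each
variable separately, satisfy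
`Σ_{U,V} (∏_{i∈U} x_i ∏_{j∈V} y_j)^N f_{U,V}(x;y) = 0` for all `N ≥ N₀` and all complex
arguments, then every `f_{U,V}` vanishes identically. -/
theorem exponential_linear_independence (L K : ℕ) (hL : 0 < L) (hK : 0 < K)
    (f : Finset (Fin L) → Finset (Fin K) → (Fin L → ℂ) → (Fin K → ℂ) → ℂ)
    (hf_x : ∀ (U : Finset (Fin L)) (V : Finset (Fin K)) (x : Fin L → ℂ) (y : Fin K → ℂ)
      (i : Fin L), Differentiable ℂ (fun z : ℂ => f U V (Function.update x i z) y))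
    (hf_y : ∀ (U : Finset (Fin L)) (V : Finset (Fin K)) (x : Fin L → ℂ) (y : Fin K → ℂ)
      (j : Fin K), Differentiable ℂ (fun z : ℂ => f U V x (Function.update y j z)))
    (N₀ : ℕ) (hN₀ : 0 < N₀)
    (hsum : ∀ N : ℕ, N₀ ≤ N → ∀ (x : Fin L → ℂ) (y : Fin K → ℂ),
      ∑ U : Finset (Fin L), ∑ V : Finset (Fin K),
        ((∏ i ∈ U, x i) * ∏ j ∈ V, y j) ^ N * f U V x y = 0) :
    ∀ (U : Finset (Fin L)) (V : Finset (Fin K)) (x : Fin L → ℂ) (y : Fin K → ℂ),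
      f U V x y = 0 := by
  intro U V x y
  let g : (Fin L ⊕ Fin K → ℂ) → ℂ := fun z => f U V (z ∘ Sum.inl) (z ∘ Sum.inr)
  have hg (z : Fin L ⊕ Fin K → ℂ) (i : Fin L ⊕ Fin K) :
      Continuous fun w => g (Function.update z i w) := by
    rcases i with i | j
    · simpa [g, Function.update_comp_eq_of_injective _ Sum.inl_injective] using
        (hf_x U V (z ∘ Sum.inl) (z ∘ Sum.inr) i).continuous
    · simpa [g, Function.update_comp_eq_of_injective _ Sum.inr_injective] using
        (hf_y U V (z ∘ Sum.inl) (z ∘ Sum.inr) j).continuous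
  refine eq_zero_of_forall_hasDistinctSubsetProducts hg Finset.univ (fun z hz => ?_) (Sum.elim x y)
  let c : Finset (Fin L) × Finset (Fin K) → ℂ := fun S => ∏ i ∈ S.1.disjSum S.2, z i
  have hc : Function.Injective c := by
    rintro ⟨U₁, V₁⟩ ⟨U₂, V₂⟩ h
    have h' := hz.2 _ (Finset.subset_univ _) _ (Finset.subset_univ _) h
    ext i
    · simpa using Finset.ext_iff.1 h' (Sum.inl i)
    · simpa using Finset.ext_iff.1 h' (Sum.inr i)
  refine eq_zero_of_forall_ge_sum_pow_mul_eq_zero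
    (h := fun S => f S.1 S.2 (z ∘ Sum.inl) (z ∘ Sum.inr)) hc (n := N₀) (fun N hN => ?_)
    (i := (U, V)) (Finset.prod_ne_zero_iff.2 fun i _ => hz.1 i (Finset.mem_univ i))
  rw [Fintype.sum_prod_type]
  simpa [c, Finset.prod_disjSum] using hsum N hN (z ∘ Sum.inl) (z ∘ Sum.inr)
end
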